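/- For every integer k ≥ 1, the T-ideal of polynomial identities of the Grassmann algebra E^{(2k)} of a 2k-dimensional vector space is generated as a T-ideal by [x₁,x₂,x₃] and the product of commutators [x₁,x₂][x₃,x₄]⋯[x_{2k+1},x_{2k+2}]. -/

import Mathlib

noncomputable section

/-- `f ∈ K⟨X⟩` (with set of variables `X`) is a polynomial identity of the `K`-algebra `R`:
every substitution of elements of `R` for the variables (i.e. every `K`-algebra homomorphism
from the free algebra to `R`) kills `f`. -/
def IsPI (K : Type) [Field K] {X : Type} (R : Type) [Ring R] [Algebra K R]
    (f : FreeAlgebra K X) : Prop :=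
  ∀ φ : FreeAlgebra K X →ₐ[K] R, φ f = 0

/-- `T(R)`: the set of polynomial identities of `R` inside `K⟨x₁, x₂, …⟩`
(the free unital associative algebra on countably many variables, indexed by `ℕ`). -/
def TId (K : Type) [Field K] (R : Type) [Ring R] [Algebra K R] : Set (FreeAlgebra K ℕ) :=
  {f | IsPI K R f}

/-- A two-sided ideal of `K⟨X⟩` is a T-ideal when it is invariant under all algebra
endomorphisms of `K⟨X⟩`. -/
def IsTIdeal (K : Type) [Field K] (I : TwoSidedIdeal (FreeAlgebra K ℕ)) : Prop :=
  ∀ φ : FreeAlgebra K ℕ →ₐ[K] FreeAlgebra K ℕ, ∀ f ∈ I, φ f ∈ I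

/-- `⟨F⟩^T`: the smallest T-ideal of `K⟨X⟩` containing the set `F`. -/
def TIdealGen (K : Type) [Field K] (F : Set (FreeAlgebra K ℕ)) : Set (FreeAlgebra K ℕ) :=
  {g | ∀ I : TwoSidedIdeal (FreeAlgebra K ℕ), IsTIdeal K I → F ⊆ (I : Set (FreeAlgebra K ℕ)) → g ∈ I}

/-- The commutator `[a, b] = a * b - b * a`. -/
def br {R : Type} [Ring R] (a b : R) : R := a * b - b * a

/-- The left-normed commutator `[a, b, b, …, b]` with `k` occurrences of `b`. -/
def commPow {R : Type} [Ring R] (a b : R) (k : ℕ) : R := (fun y => br y b)^[k] a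

/-- The variable `xᵢ` of `K⟨x₁, x₂, …⟩` (1-based indexing). -/
def xv (K : Type) [Field K] (i : ℕ) : FreeAlgebra K ℕ := FreeAlgebra.ι K i

/-- The product of commutators `[x₁,x₂][x₃,x₄]⋯[x_{2k-1},x_{2k}]`. -/
def chainProd (K : Type) [Field K] (k : ℕ) : FreeAlgebra K ℕ :=
  ((List.range k).map fun i => br (xv K (2 * i + 1)) (xv K (2 * i + 2))).prod

/-- The Grassmann (exterior) algebra of an infinite dimensional `K`-vector space
with basis `e₁, e₂, …`. -/
abbrev Einf (K : Type) [Field K] : Type := ExteriorAlgebra K (ℕ →₀ K)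

/-- The Grassmann (exterior) algebra `E⁽ⁿ⁾` of an `n`-dimensional `K`-vector space. -/
abbrev Efin (K : Type) [Field K] (n : ℕ) : Type := ExteriorAlgebra K (Fin n → K)

/-- The even part `E₀` of the Grassmann algebra of `V`. -/
def evenPart (K V : Type) [Field K] [AddCommGroup V] [Module K V] :
    Submodule K (ExteriorAlgebra K V) :=
  CliffordAlgebra.evenOdd (0 : QuadraticForm K V) 0

/-- The odd part `E₁` of the Grassmann algebra of `V`. -/
def oddPart (K V : Type) [Field K] [AddCommGroup V] [Module K V] :
    Submodule K (ExteriorAlgebra K V) :=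
  CliffordAlgebra.evenOdd (0 : QuadraticForm K V) 1

section matrixAlgebras

variable (K V : Type) [Field K] [AddCommGroup V] [Module K V]

private theorem evenPart_mul_mem {a b : ExteriorAlgebra K V}
    (ha : a ∈ evenPart K V) (hb : b ∈ evenPart K V) : a * b ∈ evenPart K V := by
  have := CliffordAlgebra.evenOdd_mul_le (Q := (0 : QuadraticForm K V)) 0 0
    (Submodule.mul_mem_mul ha hb)
  simpa [evenPart] using this

private theorem evenPart_one_mem : (1 : ExteriorAlgebra K V) ∈ evenPart K V :=
  SetLike.one_mem_graded _

private theorem evenPart_algebraMap_mem (c : K) :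
    algebraMap K (ExteriorAlgebra K V) c ∈ evenPart K V :=
  SetLike.algebraMap_mem_graded _ c

/-- The algebra `A` (over the Grassmann algebra of `V`): the subalgebra of `2 × 2`
matrices over `E = Λ(V)` whose `(1,1)` entry lies in `E₀`, whose `(2,1)` entry is `0`,
and whose `(1,2)` and `(2,2)` entries are arbitrary. -/
def algA : Subalgebra K (Matrix (Fin 2) (Fin 2) (ExteriorAlgebra K V)) where
  carrier := {M | M 0 0 ∈ evenPart K V ∧ M 1 0 = 0}
  mul_mem' := by
    rintro a b ⟨ha0, ha1⟩ ⟨hb0, hb1⟩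
    refine ⟨?_, ?_⟩
    · have h : (a * b) 0 0 = a 0 0 * b 0 0 + a 0 1 * b 1 0 := by
        simp [Matrix.mul_apply, Fin.sum_univ_two]
      rw [h, hb1, mul_zero, add_zero]
      exact evenPart_mul_mem K V ha0 hb0
    · have h : (a * b) 1 0 = a 1 0 * b 0 0 + a 1 1 * b 1 0 := by
        simp [Matrix.mul_apply, Fin.sum_univ_two]
      rw [h, ha1, hb1, zero_mul, mul_zero, add_zero]
  one_mem' := by
    refine ⟨?_, ?_⟩
    · rw [Matrix.one_apply_eq]; exact evenPart_one_mem K V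
    · exact Matrix.one_apply_ne (by decide)
  add_mem' := by
    rintro a b ⟨ha0, ha1⟩ ⟨hb0, hb1⟩
    exact ⟨Submodule.add_mem _ ha0 hb0, by simp [ha1, hb1]⟩
  zero_mem' := ⟨Submodule.zero_mem _, rfl⟩
  algebraMap_mem' := fun c => by
    refine ⟨?_, ?_⟩
    · rw [Matrix.algebraMap_matrix_apply, if_pos rfl]
      exact evenPart_algebraMap_mem K V c
    · rw [Matrix.algebraMap_matrix_apply, if_neg (by decide)]

end matrixAlgebras

section matrixAlgebras2

variable (K V : Type) [Field K] [AddCommGroup V] [Module K V]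

private theorem oddPart_mul_mem_even {a b : ExteriorAlgebra K V}
    (ha : a ∈ oddPart K V) (hb : b ∈ oddPart K V) : a * b ∈ evenPart K V := by
  have := CliffordAlgebra.evenOdd_mul_le (Q := (0 : QuadraticForm K V)) 1 1
    (Submodule.mul_mem_mul ha hb)
  have h2 : ((1 : ZMod 2) + 1) = 0 := by decide
  rw [h2] at this
  exact this

private theorem even_mul_odd_mem {a b : ExteriorAlgebra K V}
    (ha : a ∈ evenPart K V) (hb : b ∈ oddPart K V) : a * b ∈ oddPart K V := by
  have := CliffordAlgebra.evenOdd_mul_le (Q := (0 : QuadraticForm K V)) 0 1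
    (Submodule.mul_mem_mul ha hb)
  rw [zero_add] at this
  exact this

private theorem odd_mul_even_mem {a b : ExteriorAlgebra K V}
    (ha : a ∈ oddPart K V) (hb : b ∈ evenPart K V) : a * b ∈ oddPart K V := by
  have := CliffordAlgebra.evenOdd_mul_le (Q := (0 : QuadraticForm K V)) 1 0
    (Submodule.mul_mem_mul ha hb)
  rw [add_zero] at this
  exact this

/-- The algebra `A′` (over the Grassmann algebra of `V`): the subalgebra of `2 × 2`
matrices over `E = Λ(V)` whose `(2,2)` entry lies in `E₀`, whose `(2,1)` entry is `0`,
and whose `(1,1)` and `(1,2)` entries are arbitrary. -/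
def algA' : Subalgebra K (Matrix (Fin 2) (Fin 2) (ExteriorAlgebra K V)) where
  carrier := {M | M 1 1 ∈ evenPart K V ∧ M 1 0 = 0}
  mul_mem' := by
    rintro a b ⟨ha0, ha1⟩ ⟨hb0, hb1⟩
    refine ⟨?_, ?_⟩
    · have h : (a * b) 1 1 = a 1 0 * b 0 1 + a 1 1 * b 1 1 := by
        simp [Matrix.mul_apply, Fin.sum_univ_two]
      rw [h, ha1, zero_mul, zero_add]
      exact evenPart_mul_mem K V ha0 hb0
    · have h : (a * b) 1 0 = a 1 0 * b 0 0 + a 1 1 * b 1 0 := by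
        simp [Matrix.mul_apply, Fin.sum_univ_two]
      rw [h, ha1, hb1, zero_mul, mul_zero, add_zero]
  one_mem' := by
    refine ⟨?_, ?_⟩
    · rw [Matrix.one_apply_eq]; exact evenPart_one_mem K V
    · exact Matrix.one_apply_ne (by decide)
  add_mem' := by
    rintro a b ⟨ha0, ha1⟩ ⟨hb0, hb1⟩
    exact ⟨Submodule.add_mem _ ha0 hb0, by simp [ha1, hb1]⟩
  zero_mem' := ⟨Submodule.zero_mem _, rfl⟩
  algebraMap_mem' := fun c => by
    refine ⟨?_, ?_⟩
    · rw [Matrix.algebraMap_matrix_apply, if_pos rfl]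
      exact evenPart_algebraMap_mem K V c
    · rw [Matrix.algebraMap_matrix_apply, if_neg (by decide)]

/-- The algebra `M_{1,1}` (over the Grassmann algebra of `V`): the subalgebra of `2 × 2`
matrices over `E = Λ(V)` whose diagonal entries lie in `E₀` and whose off-diagonal entries
lie in `E₁`. -/
def m11 : Subalgebra K (Matrix (Fin 2) (Fin 2) (ExteriorAlgebra K V)) where
  carrier := {M | M 0 0 ∈ evenPart K V ∧ M 1 1 ∈ evenPart K V ∧
    M 0 1 ∈ oddPart K V ∧ M 1 0 ∈ oddPart K V}
  mul_mem' := by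
    rintro a b ⟨ha00, ha11, ha01, ha10⟩ ⟨hb00, hb11, hb01, hb10⟩
    have h00 : (a * b) 0 0 = a 0 0 * b 0 0 + a 0 1 * b 1 0 := by
      simp [Matrix.mul_apply, Fin.sum_univ_two]
    have h11 : (a * b) 1 1 = a 1 0 * b 0 1 + a 1 1 * b 1 1 := by
      simp [Matrix.mul_apply, Fin.sum_univ_two]
    have h01 : (a * b) 0 1 = a 0 0 * b 0 1 + a 0 1 * b 1 1 := by
      simp [Matrix.mul_apply, Fin.sum_univ_two]
    have h10 : (a * b) 1 0 = a 1 0 * b 0 0 + a 1 1 * b 1 0 := by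
      simp [Matrix.mul_apply, Fin.sum_univ_two]
    refine ⟨?_, ?_, ?_, ?_⟩
    · rw [h00]
      exact Submodule.add_mem _ (evenPart_mul_mem K V ha00 hb00)
        (oddPart_mul_mem_even K V ha01 hb10)
    · rw [h11]
      exact Submodule.add_mem _ (oddPart_mul_mem_even K V ha10 hb01)
        (evenPart_mul_mem K V ha11 hb11)
    · rw [h01]
      exact Submodule.add_mem _ (even_mul_odd_mem K V ha00 hb01)
        (odd_mul_even_mem K V ha01 hb11)
    · rw [h10]
      exact Submodule.add_mem _ (odd_mul_even_mem K V ha10 hb00)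
        (even_mul_odd_mem K V ha11 hb10)
  one_mem' := by
    refine ⟨?_, ?_, ?_, ?_⟩
    · rw [Matrix.one_apply_eq]; exact evenPart_one_mem K V
    · rw [Matrix.one_apply_eq]; exact evenPart_one_mem K V
    · rw [Matrix.one_apply_ne (by decide)]; exact Submodule.zero_mem _
    · rw [Matrix.one_apply_ne (by decide)]; exact Submodule.zero_mem _
  add_mem' := by
    rintro a b ⟨ha00, ha11, ha01, ha10⟩ ⟨hb00, hb11, hb01, hb10⟩
    exact ⟨Submodule.add_mem _ ha00 hb00, Submodule.add_mem _ ha11 hb11,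
      Submodule.add_mem _ ha01 hb01, Submodule.add_mem _ ha10 hb10⟩
  zero_mem' := ⟨Submodule.zero_mem _, Submodule.zero_mem _,
    Submodule.zero_mem _, Submodule.zero_mem _⟩
  algebraMap_mem' := fun c => by
    refine ⟨?_, ?_, ?_, ?_⟩
    · rw [Matrix.algebraMap_matrix_apply, if_pos rfl]
      exact evenPart_algebraMap_mem K V c
    · rw [Matrix.algebraMap_matrix_apply, if_pos rfl]
      exact evenPart_algebraMap_mem K V c
    · rw [Matrix.algebraMap_matrix_apply, if_neg (by decide)]
      exact Submodule.zero_mem _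
    · rw [Matrix.algebraMap_matrix_apply, if_neg (by decide)]
      exact Submodule.zero_mem _

end matrixAlgebras2

/-- The relatively free algebra `F_n(R) = K⟨x₁, …, xₙ⟩ / (K⟨x₁, …, xₙ⟩ ∩ T(R))` of rank `n`
of the variety generated by `R`: the quotient of the free algebra on `n` variables by the
ideal of polynomial identities of `R` in those variables. -/
abbrev RelFree (K : Type) [Field K] (R : Type) [Ring R] [Algebra K R] (n : ℕ) : Type :=
  RingQuot (fun f g : FreeAlgebra K (Fin n) => IsPI K R (f - g))

end
/-! ### Commutators in rings -/

/-- The product `[x_{l₁}, x_{l₂}] [x_{l₃}, x_{l₄}] ⋯` of commutators of consecutive entries of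
a list of indices, which is `0` if the list has odd length. -/
def commProd {R : Type} [Ring R] (x : ℕ → R) : List ℕ → R
  | [] => 1
  | [_] => 0
  | a :: b :: L => br (x a) (x b) * commProd x L

section commutators

variable {R : Type} [Ring R]

theorem br_swap (a b : R) : br b a = -br a b := by
  simp [br]

theorem map_br {S F : Type} [Ring S] [FunLike F R S] [RingHomClass F R S] (φ : F) (a b : R) :
    φ (br a b) = br (φ a) (φ b) := by
  simp [br]

theorem br_comm_of_br_br_eq_zero (h : ∀ a b c : R, br (br a b) c = 0) (a b c : R) :
    c * br a b = br a b * c :=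
  (sub_eq_zero.mp (h a b c)).symm

theorem br_mul_br_swap (h : ∀ a b c : R, br (br a b) c = 0) (a b c d : R) :
    br a c * br b d = -(br a b * br c d) := by
  have key : br a c * br b d + br a b * br c d = br (br a (c * b)) d
      - (br (br a c) d * b + c * br (br a b) d) + br (br a b) (br c d) := by
    simp only [br]; noncomm_ring
  simp only [h, zero_mul, mul_zero, add_zero, sub_zero] at key
  exact eq_neg_of_add_eq_zero_left key

theorem commProd_append_swap (h : ∀ a b c : R, br (br a b) c = 0) (x : ℕ → R) (a b : ℕ)
    (L : List ℕ) : ∀ P : List ℕ, commProd x (P ++ b :: a :: L) = -commProd x (P ++ a :: b :: L)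
  | [] => by simp [commProd, br_swap (x a) (x b)]
  | [d] => by
    cases L with
    | nil => simp [commProd]
    | cons e L =>
      simp only [List.cons_append, List.nil_append, commProd]
      rw [← mul_assoc, ← mul_assoc, br_mul_br_swap h, neg_mul]
  | d :: e :: P => by
    simp [commProd, commProd_append_swap h x a b L P]

theorem commProd_append_perm (h : ∀ a b c : R, br (br a b) c = 0) (x : ℕ → R) {L L' : List ℕ}
    (hL : L.Perm L') : ∀ P : List ℕ, commProd x (P ++ L) = commProd x (P ++ L') ∨
      commProd x (P ++ L) = -commProd x (P ++ L') := by
  induction hL with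
  | nil => exact fun P => Or.inl rfl
  | cons a _ ih => exact fun P => by simpa using ih (P ++ [a])
  | swap a b L => exact fun P => Or.inr (commProd_append_swap h x a b L P)
  | trans _ _ ih₁ ih₂ =>
    intro P
    rcases ih₁ P with h₁ | h₁ <;> rcases ih₂ P with h₂ | h₂ <;> simp [h₁, h₂]

theorem commProd_perm (h : ∀ a b c : R, br (br a b) c = 0) (x : ℕ → R) {L L' : List ℕ}
    (hL : L.Perm L') : commProd x L = commProd x L' ∨ commProd x L = -commProd x L' :=
  commProd_append_perm h x hL []

theorem commProd_eq_zero_of_not_nodup (h : ∀ a b c : R, br (br a b) c = 0) (x : ℕ → R)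
    {L : List ℕ} (hL : ¬ L.Nodup) : commProd x L = 0 := by
  obtain ⟨a, ha⟩ : ∃ a, List.Sublist [a, a] L := by
    simpa [List.nodup_iff_sublist] using hL
  obtain ⟨L', hL'⟩ := ha.exists_perm_append
  have h₀ : commProd x ([a, a] ++ L') = 0 := by simp [commProd, br]
  rcases commProd_perm h x hL' with h₁ | h₁ <;> rw [h₁, h₀]
  exact neg_zero

theorem commProd_mul_comm (h : ∀ a b c : R, br (br a b) c = 0) (x : ℕ → R) (r : R) :
    ∀ L : List ℕ, r * commProd x L = commProd x L * r
  | [] => by simp [commProd]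
  | [_] => by simp [commProd]
  | a :: b :: L => by
    rw [commProd, ← mul_assoc, br_comm_of_br_br_eq_zero h, mul_assoc, commProd_mul_comm h x r L,
      mul_assoc]

theorem map_commProd {S F : Type} [Ring S] [FunLike F R S] [RingHomClass F R S] (φ : F)
    (x : ℕ → R) : ∀ L : List ℕ, φ (commProd x L) = commProd (fun i => φ (x i)) L
  | [] => by simp [commProd]
  | [_] => by simp [commProd]
  | a :: b :: L => by simp [commProd, map_br, map_commProd φ x L]

theorem commProd_map (x : ℕ → R) (f : ℕ → ℕ) :
    ∀ L : List ℕ, commProd x (L.map f) = commProd (fun i => x (f i)) L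
  | [] => rfl
  | [_] => rfl
  | a :: b :: L => by simp [commProd, commProd_map x f L]

theorem commProd_range' (x : ℕ → R) (m s : ℕ) : commProd x (List.range' s (2 * m)) =
    ((List.range m).map fun i => br (x (2 * i + s)) (x (2 * i + s + 1))).prod := by
  induction m generalizing s with
  | zero => simp [commProd]
  | succ m ih =>
    rw [show 2 * (m + 1) = 2 * m + 1 + 1 by ring, List.range'_succ, List.range'_succ, commProd,
      ih, List.range_succ_eq_map]
    simp [Function.comp_def, mul_add, add_assoc, add_comm, add_left_comm]

theorem br_algebraMap_add {K : Type} [CommRing K] [Algebra K R] (r s : K) (a b : R) :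
    br (algebraMap K R r + a) (algebraMap K R s + b) = br a b := by
  have h₁ := Algebra.commutes r b
  have h₂ := Algebra.commutes s a
  have h₃ := Algebra.commutes r (algebraMap K R s)
  simp only [br, add_mul, mul_add, h₁, h₂, h₃]
  abel

/-- If commutators of algebra generators lie in a two-sided ideal, so do all commutators. -/
theorem br_mem_of_adjoin_eq_top {K : Type} [CommRing K] [Algebra K R] {s : Set R}
    (hs : Algebra.adjoin K s = ⊤) (D : Ideal R) [D.IsTwoSided]
    (h : ∀ a ∈ s, ∀ b ∈ s, br a b ∈ D) (a b : R) : br a b ∈ D := by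
  have aux : ∀ c : R, (∀ a ∈ s, br a c ∈ D) → ∀ a, br a c ∈ D := by
    intro c hc a
    have ha : a ∈ Algebra.adjoin K s := hs ▸ Algebra.mem_top
    induction ha using Algebra.adjoin_induction with
    | mem a ha => exact hc a ha
    | algebraMap r => simp [br, Algebra.commutes r c]
    | add a b _ _ ha hb =>
      rw [show br (a + b) c = br a c + br b c by simp only [br]; noncomm_ring]
      exact D.add_mem ha hb
    | mul a b _ _ ha hb =>
      rw [show br (a * b) c = a * br b c + br a c * b by simp only [br]; noncomm_ring]
      exact D.add_mem (D.mul_mem_left _ hb) (D.mul_mem_right _ ha)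
  refine aux b (fun a ha => ?_) a
  rw [br_swap]
  refine D.neg_mem (aux a (fun c hc => ?_) b)
  exact h c hc a ha

end commutators

/-! ### The exterior algebra -/

section exterior

variable {K V : Type} [Field K] [AddCommGroup V] [Module K V]

open ExteriorAlgebra (ι)

theorem ι_mul_ι_eq_neg (u v : V) : ι K u * ι K v = -(ι K v * ι K u) :=
  eq_neg_of_add_eq_zero_left (ExteriorAlgebra.ι_add_mul_swap u v)

theorem br_ι_ι (u v : V) : br (ι K u) (ι K v) = (2 : K) • (ι K u * ι K v) := by
  rw [br, ι_mul_ι_eq_neg v u, two_smul, sub_neg_eq_add]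

theorem commute_of_forall_commute_ι {z : ExteriorAlgebra K V} (hz : ∀ v : V, Commute z (ι K v))
    (a : ExteriorAlgebra K V) : Commute z a := by
  induction a using ExteriorAlgebra.induction with
  | algebraMap r => exact (Algebra.commutes r z).symm
  | ι v => exact hz v
  | mul a b ha hb => exact ha.mul_right hb
  | add a b ha hb => exact ha.add_right hb

theorem commute_ι_mul_ι (u v : V) (a : ExteriorAlgebra K V) : Commute (ι K u * ι K v) a :=
  commute_of_forall_commute_ι (fun w => by
    rw [Commute, SemiconjBy, mul_assoc, ι_mul_ι_eq_neg v w, mul_neg, ← mul_assoc,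
      ι_mul_ι_eq_neg u w, neg_mul, neg_neg, mul_assoc]) a

/-- Every element of an exterior algebra is the sum of a central element and an element
anticommuting with all vectors. -/
theorem exists_commute_add_anticommute (a : ExteriorAlgebra K V) :
    ∃ z o, a = z + o ∧ (∀ v : V, z * ι K v = ι K v * z) ∧ ∀ v : V, o * ι K v = -(ι K v * o) := by
  induction a using ExteriorAlgebra.induction with
  | algebraMap r =>
    exact ⟨_, 0, (add_zero _).symm, fun v => Algebra.commutes r _, fun v => by simp⟩
  | ι u => exact ⟨0, _, (zero_add _).symm, fun v => by simp, ι_mul_ι_eq_neg u⟩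
  | add a b ha hb =>
    obtain ⟨z, o, rfl, hz, ho⟩ := ha
    obtain ⟨z', o', rfl, hz', ho'⟩ := hb
    exact ⟨z + z', o + o', add_add_add_comm _ _ _ _,
      fun v => by rw [add_mul, hz, hz', mul_add],
      fun v => by rw [add_mul, ho, ho', mul_add, neg_add]⟩
  | mul a b ha hb =>
    obtain ⟨z, o, rfl, hz, ho⟩ := ha
    obtain ⟨z', o', rfl, hz', ho'⟩ := hb
    refine ⟨z * z' + o * o', z * o' + o * z', by noncomm_ring, fun v => ?_, fun v => ?_⟩
    · rw [add_mul, mul_assoc, hz', ← mul_assoc, hz, mul_assoc o, ho', mul_neg, ← mul_assoc o, ho]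
      noncomm_ring
    · rw [add_mul, mul_assoc, ho', mul_neg, ← mul_assoc, hz, mul_assoc o, hz', ← mul_assoc o, ho]
      noncomm_ring

theorem br_br_exteriorAlgebra (a b c : ExteriorAlgebra K V) : br (br a b) c = 0 := by
  obtain ⟨z, o, rfl, hz, ho⟩ := exists_commute_add_anticommute a
  obtain ⟨z', o', rfl, hz', ho'⟩ := exists_commute_add_anticommute b
  have hzc := fun d => commute_of_forall_commute_ι hz d
  have hzc' := fun d => commute_of_forall_commute_ι hz' d
  have e : br (z + o) (z' + o') = br o o' := by
    simp only [br, add_mul, mul_add, (hzc z').eq, (hzc o').eq, (hzc' o).eq]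
    abel
  rw [e, br, sub_eq_zero]
  refine commute_of_forall_commute_ι (fun v => ?_) c
  rw [Commute, SemiconjBy, br, sub_mul, mul_assoc, ho', mul_neg, ← mul_assoc, ho, mul_assoc o',
    ho, mul_neg, ← mul_assoc o', ho']
  noncomm_ring

/-- The left ideal generated by the products of `m` vectors. -/
def vectorProdIdeal (K V : Type) [Field K] [AddCommGroup V] [Module K V] (m : ℕ) :
    Ideal (ExteriorAlgebra K V) :=
  Ideal.span {a | ∃ v : Fin m → V, a = ExteriorAlgebra.ιMulti K m v}

theorem vectorProdIdeal_eq_bot [FiniteDimensional K V] {m : ℕ} (hm : Module.finrank K V < m) :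
    vectorProdIdeal K V m = ⊥ := by
  rw [vectorProdIdeal, Ideal.span_eq_bot]
  rintro _ ⟨v, rfl⟩
  refine AlternatingMap.map_linearDependent _ v fun hv => ?_
  have := hv.fintype_card_le_finrank
  rw [Fintype.card_fin] at this
  exact this.not_gt hm

theorem ιMulti_two (u : Fin 2 → V) : ExteriorAlgebra.ιMulti K 2 u = ι K (u 0) * ι K (u 1) := by
  rw [ExteriorAlgebra.ιMulti_succ_apply, ExteriorAlgebra.ιMulti_succ_apply,
    ExteriorAlgebra.ιMulti_zero_apply, mul_one]
  rfl

theorem ιMulti_add_two (m : ℕ) (u v : V) (w : Fin m → V) :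
    ι K u * ι K v * ExteriorAlgebra.ιMulti K m w =
      ExteriorAlgebra.ιMulti K (m + 2) (Matrix.vecCons u (Matrix.vecCons v w)) := by
  rw [ExteriorAlgebra.ιMulti_succ_apply, ExteriorAlgebra.ιMulti_succ_apply, mul_assoc]
  simp

theorem mul_mem_vectorProdIdeal {m : ℕ} {a b : ExteriorAlgebra K V}
    (ha : a ∈ vectorProdIdeal K V 2) (hb : b ∈ vectorProdIdeal K V m) :
    a * b ∈ vectorProdIdeal K V (m + 2) := by
  induction ha using Submodule.span_induction with
  | mem a ha =>
    obtain ⟨u, rfl⟩ := ha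
    rw [ιMulti_two]
    induction hb using Submodule.span_induction with
    | mem b hb =>
      obtain ⟨w, rfl⟩ := hb
      exact Ideal.subset_span ⟨_, ιMulti_add_two m _ _ w⟩
    | zero => simp
    | add b c _ _ hb hc => rw [mul_add]; exact Ideal.add_mem _ hb hc
    | smul r b _ hb =>
      rw [smul_eq_mul, ← mul_assoc, (commute_ι_mul_ι _ _ r).eq, mul_assoc]
      exact Ideal.mul_mem_left _ _ hb
  | zero => simp
  | add a c _ _ ha hc => rw [add_mul]; exact Ideal.add_mem _ ha hc
  | smul r a _ ha => rw [smul_eq_mul, mul_assoc]; exact Ideal.mul_mem_left _ _ ha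

instance : (vectorProdIdeal K V 2).IsTwoSided := by
  refine ⟨fun {a} b ha => ?_⟩
  induction ha using Submodule.span_induction with
  | mem a ha =>
    obtain ⟨u, rfl⟩ := ha
    have hmem := Ideal.mul_mem_left _ b (Ideal.subset_span ⟨u, rfl⟩ :
      ExteriorAlgebra.ιMulti K 2 u ∈ vectorProdIdeal K V 2)
    rwa [ιMulti_two, ← (commute_ι_mul_ι _ _ b).eq, ← ιMulti_two] at hmem
  | zero => simp
  | add a c _ _ ha hc => rw [add_mul]; exact Ideal.add_mem _ ha hc
  | smul r a _ ha => rw [smul_eq_mul, mul_assoc]; exact Ideal.mul_mem_left _ _ ha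

theorem br_mem_vectorProdIdeal (a b : ExteriorAlgebra K V) : br a b ∈ vectorProdIdeal K V 2 := by
  refine br_mem_of_adjoin_eq_top (CliffordAlgebra.adjoin_range_ι (Q := (0 : QuadraticForm K V)))
    _ ?_ a b
  rintro _ ⟨u, rfl⟩ _ ⟨v, rfl⟩
  change br (ι K u) (ι K v) ∈ _
  rw [br_ι_ι, Algebra.smul_def]
  refine Ideal.mul_mem_left _ _ (Ideal.subset_span ⟨![u, v], ?_⟩)
  simp [ExteriorAlgebra.ιMulti_apply]

theorem commProd_mem_vectorProdIdeal (y : ℕ → ExteriorAlgebra K V) :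
    ∀ L : List ℕ, commProd y L ∈ vectorProdIdeal K V L.length
  | [] => Ideal.subset_span ⟨0, by simp [commProd]⟩
  | [_] => Ideal.zero_mem _
  | _ :: _ :: L =>
    mul_mem_vectorProdIdeal (br_mem_vectorProdIdeal _ _) (commProd_mem_vectorProdIdeal y L)

/-- The product of the vectors attached to a list of indices. -/
def vectorProd (e : ℕ → V) (L : List ℕ) : ExteriorAlgebra K V :=
  (L.map fun i => ι K (e i)).prod

theorem vectorProd_eq_ιMulti (e : ℕ → V) (L : List ℕ) : vectorProd (K := K) e L =
    ExteriorAlgebra.ιMulti K L.length fun j => e (L.get j) := by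
  rw [vectorProd, ExteriorAlgebra.ιMulti_apply]
  conv_lhs => rw [← List.ofFn_get L, List.map_ofFn]
  rfl

theorem ι_mul_vectorProd (e : ℕ → V) {L : List ℕ} {i : ℕ} (hi : i ∈ L) :
    ι K (e i) * vectorProd e L = 0 := by
  obtain ⟨j, rfl⟩ := List.get_of_mem hi
  rw [vectorProd_eq_ιMulti, ExteriorAlgebra.ιMulti_apply]
  exact ExteriorAlgebra.ι_mul_prod_list (fun j => e (L.get j)) j

theorem vectorProd_eq_zero (e : ℕ → V) {L : List ℕ} {i : ℕ} (hi : i ∈ L) (he : e i = 0) :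
    vectorProd (K := K) e L = 0 :=
  List.prod_eq_zero (List.mem_map.mpr ⟨i, hi, by rw [he, map_zero]⟩)

theorem exists_vectorProd_ne_zero {n : ℕ} {L : List ℕ} (hL : L.Nodup) (hn : L.length ≤ n) :
    ∃ e : ℕ → Fin n → K, (∀ i ∉ L, e i = 0) ∧ vectorProd (K := K) e L ≠ 0 := by
  classical
  refine ⟨fun i j => if i ∈ L ∧ L.idxOf i = j then 1 else 0, fun i hi => by ext; simp [hi], ?_⟩
  intro h
  have h' := congrArg (ExteriorAlgebra.liftAlternating (R := K) (N := K) (Pi.single L.length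
    (Matrix.detRowAlternating.compLinearMap (LinearMap.funLeft K K (Fin.castLE hn))))) h
  rw [vectorProd_eq_ιMulti, ExteriorAlgebra.liftAlternating_apply_ιMulti, Pi.single_eq_same,
    map_zero, AlternatingMap.compLinearMap_apply] at h'
  refine one_ne_zero (α := K) (Eq.trans (Matrix.det_one (n := Fin L.length)).symm (Eq.trans ?_ h'))
  change Matrix.detRowAlternating _ = _
  congr 1
  ext i j
  simp [LinearMap.funLeft_apply, Matrix.one_apply, hL.idxOf_getElem, Fin.ext_iff]

theorem commProd_add_ι (t : ℕ → K) (e : ℕ → V) : ∀ (m : ℕ) (L : List ℕ), L.length = 2 * m →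
    commProd (fun i => algebraMap K (ExteriorAlgebra K V) (t i) + ι K (e i)) L =
      (2 : K) ^ m • vectorProd e L
  | 0, [], _ => by simp [commProd, vectorProd]
  | m + 1, a :: b :: L, h => by
    rw [commProd, br_algebraMap_add, br_ι_ι, commProd_add_ι t e m L (by simp at h; omega)]
    simp only [vectorProd, List.map_cons, List.prod_cons, smul_mul_smul_comm, mul_assoc, pow_succ']

theorem lift_mul_vectorProd (t : ℕ → K) (e : ℕ → V) {L : List ℕ} (he : ∀ i ∉ L, e i = 0)
    (p : FreeAlgebra K ℕ) :
    FreeAlgebra.lift K (fun i => algebraMap K (ExteriorAlgebra K V) (t i) + ι K (e i)) p *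
      vectorProd e L = FreeAlgebra.lift K t p • vectorProd e L := by
  induction p using FreeAlgebra.induction with
  | grade0 r => simp [Algebra.smul_def]
  | grade1 i =>
    have h : ι K (e i) * vectorProd e L = 0 := by
      by_cases hi : i ∈ L
      · exact ι_mul_vectorProd e hi
      · simp [he i hi]
    simp [add_mul, h, Algebra.smul_def]
  | mul a b ha hb => rw [map_mul, mul_assoc, hb, mul_smul_comm, ha, smul_smul, map_mul, mul_comm]
  | add a b ha hb => rw [map_add, add_mul, ha, hb, map_add, add_smul]

end exterior

/-! ### Algebras with central commutators -/

section central

variable {K Q : Type} [Field K] [Ring Q] [Algebra K Q]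

/-- The left ideal generated by the products of `m` commutators of the elements `x i`. -/
def commIdeal (x : ℕ → Q) (m : ℕ) : Ideal Q :=
  Ideal.span {q | ∃ L : List ℕ, L.length = 2 * m ∧ q = commProd x L}

theorem commProd_mem_commIdeal (x : ℕ → Q) {m : ℕ} {L : List ℕ} (hL : L.length = 2 * m) :
    commProd x L ∈ commIdeal x m :=
  Ideal.subset_span ⟨L, hL, rfl⟩

theorem commIdeal_zero (x : ℕ → Q) : commIdeal x 0 = ⊤ :=
  (Ideal.eq_top_iff_one _).mpr (commProd_mem_commIdeal x (L := []) rfl)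

/-- Up to sign, it is enough to use each set of indices once. -/
theorem commIdeal_le_span_finset (h : ∀ a b c : Q, br (br a b) c = 0) (x : ℕ → Q) (m : ℕ) :
    commIdeal x m ≤ Ideal.span
      (Set.range fun J : {J : Finset ℕ // J.card = 2 * m} => commProd x J.1.toList) := by
  refine Ideal.span_le.mpr ?_
  rintro _ ⟨L, hL, rfl⟩
  by_cases hd : L.Nodup
  · have hmem : commProd x L.toFinset.toList ∈ Ideal.span
        (Set.range fun J : {J : Finset ℕ // J.card = 2 * m} => commProd x J.1.toList) :=
      Ideal.subset_span ⟨⟨L.toFinset, by rw [List.toFinset_card_of_nodup hd, hL]⟩, rfl⟩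
    rcases commProd_perm h x (List.toFinset_toList hd).symm with h₁ | h₁
    · rw [h₁]; exact hmem
    · rw [h₁]; exact neg_mem hmem
  · rw [commProd_eq_zero_of_not_nodup h x hd]
    exact Ideal.zero_mem _

theorem isTwoSided_commIdeal (h : ∀ a b c : Q, br (br a b) c = 0) (x : ℕ → Q) (m : ℕ) :
    (commIdeal x m).IsTwoSided := by
  refine ⟨fun {a} b ha => ?_⟩
  induction ha using Submodule.span_induction with
  | mem a ha =>
    obtain ⟨L, hL, rfl⟩ := ha
    rw [← commProd_mul_comm h]
    exact Ideal.mul_mem_left _ _ (commProd_mem_commIdeal x hL)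
  | zero => simp
  | add a c _ _ ha hc => rw [add_mul]; exact Ideal.add_mem _ ha hc
  | smul r a _ ha => rw [smul_eq_mul, mul_assoc]; exact Ideal.mul_mem_left _ _ ha

theorem mul_commProd_mem_commIdeal (x : ℕ → Q) {m : ℕ} {L : List ℕ} (hL : L.length = 2 * m)
    {p : Q} (hp : p ∈ commIdeal x 1) : p * commProd x L ∈ commIdeal x (m + 1) := by
  induction hp using Submodule.span_induction with
  | mem a ha =>
    obtain ⟨L', hL', rfl⟩ := ha
    obtain ⟨a, b, rfl⟩ := List.length_eq_two.mp hL'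
    have := commProd_mem_commIdeal x (L := a :: b :: L) (m := m + 1) (by simp [hL, mul_add])
    simpa [commProd] using this
  | zero => simp
  | add a c _ _ ha hc => rw [add_mul]; exact Ideal.add_mem _ ha hc
  | smul r a _ ha => rw [smul_eq_mul, mul_assoc]; exact Ideal.mul_mem_left _ _ ha

/-- A noncommutative polynomial vanishing at all scalar points lies in the commutator ideal. -/
theorem lift_mem_commIdeal_one [CharZero K] (h : ∀ a b c : Q, br (br a b) c = 0) {x : ℕ → Q}
    (hx : Function.Surjective (FreeAlgebra.lift K x)) {P : FreeAlgebra K ℕ}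
    (hP : ∀ t : ℕ → K, FreeAlgebra.lift K t P = 0) :
    FreeAlgebra.lift K x P ∈ commIdeal x 1 := by
  have := isTwoSided_commIdeal h x 1
  have hadj : Algebra.adjoin K (Set.range x) = ⊤ := by
    rw [← top_le_iff]
    rintro q -
    obtain ⟨p, rfl⟩ := hx q
    have hp : p ∈ Algebra.adjoin K (Set.range (FreeAlgebra.ι K)) := by
      rw [FreeAlgebra.adjoin_range_ι]; trivial
    have : FreeAlgebra.lift K x p ∈ (Algebra.adjoin K (Set.range (FreeAlgebra.ι K))).map
        (FreeAlgebra.lift K x) := ⟨p, hp, rfl⟩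
    rw [AlgHom.map_adjoin, ← Set.range_comp] at this
    simpa [Function.comp_def] using this
  have hbr : ∀ a b : Q, br a b ∈ commIdeal x 1 := by
    refine br_mem_of_adjoin_eq_top hadj _ ?_
    rintro _ ⟨i, rfl⟩ _ ⟨j, rfl⟩
    simpa [commProd] using commProd_mem_commIdeal x (L := [i, j]) (m := 1) rfl
  let _ : CommRing (Q ⧸ commIdeal x 1) :=
    { (inferInstance : Ring (Q ⧸ commIdeal x 1)) with
      mul_comm := by
        intro a b
        obtain ⟨a, rfl⟩ := Ideal.Quotient.mk_surjective a
        obtain ⟨b, rfl⟩ := Ideal.Quotient.mk_surjective b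
        rw [← map_mul, ← map_mul]
        exact Ideal.Quotient.eq.mpr (hbr a b) }
  let g : MvPolynomial ℕ K →ₐ[K] Q ⧸ commIdeal x 1 :=
    MvPolynomial.aeval fun i => Ideal.Quotient.mk (commIdeal x 1) (x i)
  let ab : FreeAlgebra K ℕ →ₐ[K] MvPolynomial ℕ K := FreeAlgebra.lift K MvPolynomial.X
  have hab : ab P = 0 := by
    refine MvPolynomial.funext fun t => ?_
    have : (MvPolynomial.aeval t).comp ab = FreeAlgebra.lift K t := by
      ext i; simp [ab]
    have := DFunLike.congr_fun this P
    rw [hP] at this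
    simpa [MvPolynomial.aeval_eq_eval] using this
  have hg : g.comp ab = (Ideal.Quotient.mkₐ K (commIdeal x 1)).comp (FreeAlgebra.lift K x) := by
    ext i; simp [g, ab]
  have := DFunLike.congr_fun hg P
  simp only [AlgHom.comp_apply, hab, map_zero] at this
  exact Ideal.Quotient.eq_zero_iff_mem.mp this.symm

theorem mem_commIdeal_succ [CharZero K] {n m : ℕ} (hm : 2 * m ≤ n)
    (h : ∀ a b c : Q, br (br a b) c = 0) {x : ℕ → Q}
    (hx : Function.Surjective (FreeAlgebra.lift K x))
    (hlift : ∀ y : ℕ → Efin K n, ∃ ψ : Q →ₐ[K] Efin K n, ∀ i, ψ (x i) = y i)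
    {q : Q} (hq : ∀ ψ : Q →ₐ[K] Efin K n, ψ q = 0) (hqm : q ∈ commIdeal x m) :
    q ∈ commIdeal x (m + 1) := by
  obtain ⟨c, rfl⟩ :=
    Finsupp.mem_span_range_iff_exists_finsupp.mp (commIdeal_le_span_finset h x m hqm)
  refine Submodule.sum_mem _ fun J hJ => ?_
  have hJl : J.1.toList.length = 2 * m := by rw [Finset.length_toList, J.2]
  refine mul_commProd_mem_commIdeal x hJl ?_
  obtain ⟨P, hP⟩ := hx (c J)
  rw [← hP]
  refine lift_mem_commIdeal_one h hx fun t => ?_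
  obtain ⟨e, he, hne⟩ :=
    exists_vectorProd_ne_zero (K := K) (Finset.nodup_toList J.1) (hJl.trans_le hm)
  obtain ⟨ψ, hψ⟩ := hlift fun i => algebraMap K _ (t i) + ExteriorAlgebra.ι K (e i)
  have hcomm : ∀ J' : {J : Finset ℕ // J.card = 2 * m}, ψ (commProd x J'.1.toList) =
      (2 : K) ^ m • vectorProd e J'.1.toList := fun J' => by
    rw [map_commProd]
    simp only [hψ]
    exact commProd_add_ι t e m _ (by rw [Finset.length_toList, J'.2])
  have hsum := hq ψ
  rw [Finsupp.sum, map_sum, Finset.sum_eq_single_of_mem J hJ] at hsum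
  · have hcomp : ψ.comp (FreeAlgebra.lift K x) = FreeAlgebra.lift K
        (fun i => algebraMap K (Efin K n) (t i) + ExteriorAlgebra.ι K (e i)) := by
      ext i; simp [hψ]
    rw [smul_eq_mul, map_mul, hcomm, ← hP, ← AlgHom.comp_apply, hcomp, mul_smul_comm,
      lift_mul_vectorProd t e he, smul_smul] at hsum
    exact (mul_eq_zero.mp ((smul_eq_zero.mp hsum).resolve_right hne)).resolve_left
      (pow_ne_zero _ two_ne_zero)
  · intro J' _ hJ'
    obtain ⟨i, hi, hiJ⟩ : ∃ i ∈ J'.1, i ∉ J.1 := by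
      by_contra! hsub
      exact hJ' (Subtype.ext (Finset.eq_of_subset_of_card_le hsub (by rw [J.2, J'.2])))
    rw [smul_eq_mul, map_mul, hcomm, vectorProd_eq_zero e (Finset.mem_toList.mpr hi)
      (he i (by simpa using hiJ)), smul_zero, mul_zero]

theorem eq_zero_of_forall_algHom_efin [CharZero K] {k : ℕ}
    (h : ∀ a b c : Q, br (br a b) c = 0) {x : ℕ → Q}
    (hx : Function.Surjective (FreeAlgebra.lift K x))
    (hprod : ∀ L : List ℕ, L.length = 2 * (k + 1) → commProd x L = 0)
    (hlift : ∀ y : ℕ → Efin K (2 * k), ∃ ψ : Q →ₐ[K] Efin K (2 * k), ∀ i, ψ (x i) = y i)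
    {q : Q} (hq : ∀ ψ : Q →ₐ[K] Efin K (2 * k), ψ q = 0) : q = 0 := by
  have hmem : ∀ m ≤ k + 1, q ∈ commIdeal x m := by
    intro m
    induction m with
    | zero => intro _; rw [commIdeal_zero]; trivial
    | succ m ih => exact fun hm => mem_commIdeal_succ (by omega) h hx hlift hq (ih (by omega))
  have hbot : commIdeal x (k + 1) = ⊥ := by
    rw [commIdeal, Ideal.span_eq_bot]
    rintro _ ⟨L, hL, rfl⟩
    exact hprod L hL
  have := hmem (k + 1) le_rfl
  rwa [hbot, Ideal.mem_bot] at this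

end central

/-! ### T-ideals -/

section tideal

variable {K : Type} [Field K]

/-- The polynomial identities of an algebra form a two-sided ideal. -/
def identityIdeal (K : Type) [Field K] (R : Type) [Ring R] [Algebra K R] :
    TwoSidedIdeal (FreeAlgebra K ℕ) :=
  .mk' (TId K R) (fun φ => map_zero φ)
    (fun hx hy φ => by rw [map_add, hx φ, hy φ, add_zero])
    (fun hx φ => by rw [map_neg, hx φ, neg_zero])
    (fun hy φ => by rw [map_mul, hy φ, mul_zero])
    (fun hx φ => by rw [map_mul, hx φ, zero_mul])

theorem mem_identityIdeal {R : Type} [Ring R] [Algebra K R] {f : FreeAlgebra K ℕ} :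
    f ∈ identityIdeal K R ↔ ∀ φ : FreeAlgebra K ℕ →ₐ[K] R, φ f = 0 :=
  TwoSidedIdeal.mem_mk' (TId K R) _ _ _ _ _ f

theorem isTIdeal_identityIdeal (R : Type) [Ring R] [Algebra K R] :
    IsTIdeal K (identityIdeal K R) := by
  intro φ f hf
  rw [mem_identityIdeal] at hf ⊢
  exact fun ψ => hf (ψ.comp φ)

theorem IsTIdeal.inf {I J : TwoSidedIdeal (FreeAlgebra K ℕ)} (hI : IsTIdeal K I)
    (hJ : IsTIdeal K J) : IsTIdeal K (I ⊓ J) := by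
  intro φ f hf
  rw [TwoSidedIdeal.mem_inf] at hf ⊢
  exact ⟨hI φ f hf.1, hJ φ f hf.2⟩

theorem chainProd_eq_commProd (m : ℕ) :
    chainProd K m = commProd (xv K) (List.range' 1 (2 * m)) := by
  rw [commProd_range', chainProd]

theorem generators_subset_identityIdeal (k : ℕ) :
    {br (br (xv K 1) (xv K 2)) (xv K 3), chainProd K (k + 1)} ⊆
      (identityIdeal K (Efin K (2 * k)) : Set (FreeAlgebra K ℕ)) := by
  rintro f (rfl | rfl) <;> rw [SetLike.mem_coe, mem_identityIdeal] <;> intro φ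
  · rw [map_br, map_br, br_br_exteriorAlgebra]
  · rw [chainProd_eq_commProd, map_commProd]
    have hmem := commProd_mem_vectorProdIdeal (fun i => φ (xv K i)) (List.range' 1 (2 * (k + 1)))
    rwa [List.length_range', vectorProdIdeal_eq_bot (by simp [mul_add]), Ideal.mem_bot] at hmem

theorem IsTIdeal.br_br_mem {I : TwoSidedIdeal (FreeAlgebra K ℕ)} (hI : IsTIdeal K I)
    (h : br (br (xv K 1) (xv K 2)) (xv K 3) ∈ I) (a b c : FreeAlgebra K ℕ) :
    br (br a b) c ∈ I := by
  have := hI (FreeAlgebra.lift K fun i => if i = 1 then a else if i = 2 then b else c) _ h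
  simpa [map_br, xv] using this

theorem IsTIdeal.commProd_mem {I : TwoSidedIdeal (FreeAlgebra K ℕ)} (hI : IsTIdeal K I) {m : ℕ}
    (h : chainProd K m ∈ I) {L : List ℕ} (hL : L.length = 2 * m) :
    commProd (xv K) L ∈ I := by
  have := hI (FreeAlgebra.lift K fun i => xv K (L.getD (i - 1) 0)) _ h
  rw [chainProd_eq_commProd, map_commProd] at this
  have hmap : (List.range' 1 (2 * m)).map (fun i => L.getD (i - 1) 0) = L := by
    refine List.ext_getElem (by simp [hL]) fun i h₁ h₂ => ?_
    simp [h₂]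
  rw [← hmap, commProd_map]
  simpa [xv] using this

end tideal

/-- For `k ≥ 1`, the T-ideal of identities of the Grassmann algebra `E⁽²ᵏ⁾`
of a `2k`-dimensional space is generated as a T-ideal by `[x₁,x₂,x₃]` and
`[x₁,x₂][x₃,x₄]⋯[x_{2k+1},x_{2k+2}]`. -/
theorem tideal_grassmann_fin_eq_gen (K : Type) [Field K] [CharZero K] (k : ℕ) (hk : 1 ≤ k) :
    TId K (Efin K (2 * k)) =
      TIdealGen K {br (br (xv K 1) (xv K 2)) (xv K 3), chainProd K (k + 1)} := by
  refine Set.Subset.antisymm (fun f hf I hI hgen => ?_) (fun f hf => ?_)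
  · let J := I ⊓ identityIdeal K (Efin K (2 * k))
    have hJ : IsTIdeal K J := hI.inf (isTIdeal_identityIdeal _)
    have hgenJ : ∀ g ∈ ({br (br (xv K 1) (xv K 2)) (xv K 3), chainProd K (k + 1)} :
        Set (FreeAlgebra K ℕ)), g ∈ J := fun g hg =>
      (TwoSidedIdeal.mem_inf _).mpr ⟨hgen hg, generators_subset_identityIdeal k hg⟩
    let π := Ideal.Quotient.mkₐ K J.asIdeal
    have hπ : ∀ g, π g = 0 ↔ g ∈ J := fun g =>
      Ideal.Quotient.eq_zero_iff_mem.trans TwoSidedIdeal.mem_asIdeal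
    have hsurj : Function.Surjective π := Ideal.Quotient.mkₐ_surjective K J.asIdeal
    have hlift : FreeAlgebra.lift K (fun i => π (xv K i)) = π := by
      ext i; simp [xv]
    have hzero : π f = 0 := by
      refine eq_zero_of_forall_algHom_efin (K := K) (k := k) (x := fun i => π (xv K i))
        (fun a b c => ?_) (by rwa [hlift]) (fun L hL => ?_) (fun y => ?_) (fun ψ => ?_)
      · obtain ⟨a, rfl⟩ := hsurj a
        obtain ⟨b, rfl⟩ := hsurj b
        obtain ⟨c, rfl⟩ := hsurj c
        rw [← map_br, ← map_br, hπ]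
        exact hJ.br_br_mem (hgenJ _ (Or.inl rfl)) a b c
      · rw [← map_commProd, hπ]
        exact hJ.commProd_mem (hgenJ _ (Or.inr rfl)) hL
      · refine ⟨Ideal.Quotient.liftₐ J.asIdeal (FreeAlgebra.lift K y) fun a ha => ?_, fun i => ?_⟩
        · exact mem_identityIdeal.mp
            ((TwoSidedIdeal.mem_inf _).mp (TwoSidedIdeal.mem_asIdeal.mp ha)).2 _
        · exact FreeAlgebra.lift_ι_apply y i
      · exact hf (ψ.comp π)
    exact ((TwoSidedIdeal.mem_inf _).mp ((hπ f).mp hzero)).1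
  · exact mem_identityIdeal.mp
      (hf _ (isTIdeal_identityIdeal _) (generators_subset_identityIdeal k))
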